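/- For every sequence (G_n) of simple graphs, if χ(G_n) → ∞ then cc(L(G_n)) → ∞; equivalently, for every integer b there exists an integer c such that every graph G with χ(G) ≥ c satisfies cc(L(G)) > b. -/

import Mathlib

open SimpleGraph

/-- A graph is chordal if it has no induced cycle of length more than three. -/
def IsChordal {V : Type*} (G : SimpleGraph V) : Prop :=
  ∀ n : ℕ, 3 < n → IsEmpty (cycleGraph n ↪g G)

/-- A graph is an interval graph if it is the intersection graph of a family of
closed real intervals. -/
def IsIntervalGraph {V : Type*} (G : SimpleGraph V) : Prop :=
  ∃ a b : V → ℝ, (∀ v, a v ≤ b v) ∧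
    ∀ u v, G.Adj u v ↔ u ≠ v ∧ (Set.Icc (a u) (b u) ∩ Set.Icc (a v) (b v)).Nonempty

/-- A graph is an equivalence graph if it is a disjoint union of cliques. -/
def IsEquivalenceGraph {V : Type*} (G : SimpleGraph V) : Prop :=
  ∀ u v w, G.Adj u v → G.Adj v w → u ≠ w → G.Adj u w

/-- The minimum number of graphs satisfying `P` whose (edge-)union is `G`. -/
noncomputable def coverNumber {V : Type*} (P : SimpleGraph V → Prop)
    (G : SimpleGraph V) : ℕ :=
  sInf {k | ∃ f : Fin k → SimpleGraph V, (∀ i, P (f i)) ∧ (⨆ i, f i) = G}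

/-- The chordal covering number. -/
noncomputable def chordalCoverNumber {V : Type*} (G : SimpleGraph V) : ℕ :=
  coverNumber IsChordal G

/-- The track number. -/
noncomputable def trackNumber {V : Type*} (G : SimpleGraph V) : ℕ :=
  coverNumber IsIntervalGraph G

/-- The equivalence covering number. -/
noncomputable def eqCoverNumber {V : Type*} (G : SimpleGraph V) : ℕ :=
  coverNumber IsEquivalenceGraph G

/-- An orientation of a simple graph: each edge gets exactly one of its two directions. -/
structure GraphOrientation {V : Type*} (G : SimpleGraph V) where
  dir : V → V → Prop
  adj_iff : ∀ u v, G.Adj u v ↔ (dir u v ∨ dir v u)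
  asymm : ∀ u v, dir u v → ¬ dir v u

/-- Edges `xy` and `xz` form an elbow at `x`: both towards `x` or both away from `x`. -/
def GraphOrientation.IsElbow {V : Type*} {G : SimpleGraph V} (o : GraphOrientation G)
    (x y z : V) : Prop :=
  (o.dir y x ∧ o.dir z x) ∨ (o.dir x y ∧ o.dir x z)

/-- Edges `xy` and `xz` form an in-elbow at `x`: both directed towards `x`. -/
def GraphOrientation.IsInElbow {V : Type*} {G : SimpleGraph V} (o : GraphOrientation G)
    (x y z : V) : Prop :=
  o.dir y x ∧ o.dir z x

/-- The minimum size of an elbow cover of `G`. -/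
noncomputable def elbowCoverNumber {V : Type*} (G : SimpleGraph V) : ℕ :=
  sInf {k | ∃ f : Fin k → GraphOrientation G,
    ∀ x y z, G.Adj x y → G.Adj x z → y ≠ z → ∃ i, (f i).IsElbow x y z}

/-- The minimum size of an in-elbow cover of `G`. -/
noncomputable def inElbowCoverNumber {V : Type*} (G : SimpleGraph V) : ℕ :=
  sInf {k | ∃ f : Fin k → GraphOrientation G,
    ∀ x y z, G.Adj x y → G.Adj x z → y ≠ z → ∃ i, (f i).IsInElbow x y z}

/-- The graph `G` with only the edges inside `B` retained. -/
def SimpleGraph.within {V : Type*} (G : SimpleGraph V) (B : Set V) : SimpleGraph V where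
  Adj a b := G.Adj a b ∧ a ∈ B ∧ b ∈ B
  symm := ⟨fun _ _ h => ⟨h.1.symm, h.2.2, h.2.1⟩⟩

theorem SimpleGraph.within_mono {V : Type*} (G : SimpleGraph V) {B C : Set V} (h : B ⊆ C) :
    G.within B ≤ G.within C :=
  fun _ _ hab => ⟨hab.1, h hab.2.1, h hab.2.2⟩

theorem IsChordal.not_isHole {V : Type*} {G : SimpleGraph V} (hG : IsChordal G) {n : ℕ}
    (hn : 3 < n) (f : ℕ → V)
    (hf : ∀ i j, i < j → j < n →
      f i ≠ f j ∧ (G.Adj (f i) (f j) ↔ j = i + 1 ∨ (i = 0 ∧ j + 1 = n))) : False := by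
  have key : ∀ i j : Fin n, i < j →
      ((cycleGraph n).Adj i j ↔ (j : ℕ) = i + 1 ∨ ((i : ℕ) = 0 ∧ (j : ℕ) + 1 = n)) := by
    intro i j hij
    have h1 : ((j - i : Fin n) : ℕ) = j - i := Fin.sub_val_of_le hij.le
    have h2 : ((i - j : Fin n) : ℕ) = n + i - j := Fin.coe_sub_iff_lt.2 hij
    rw [cycleGraph_adj', h1, h2]
    have := i.isLt
    have := j.isLt
    have : (i : ℕ) < j := hij
    omega
  refine (hG n hn).false ⟨⟨fun i => f i, fun i j hij => ?_⟩, fun {i j} => ?_⟩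
  · rcases lt_trichotomy i j with h | h | h
    · exact absurd hij (hf i j h j.isLt).1
    · exact h
    · exact absurd hij.symm (hf j i h i.isLt).1
  · change G.Adj (f i) (f j) ↔ _
    rcases lt_trichotomy i j with h | h | h
    · rw [key i j h, (hf i j h j.isLt).2]
    · subst h
      simp
    · rw [G.adj_comm, (cycleGraph n).adj_comm, key j i h, (hf j i h i.isLt).2]

/-- In a chordal graph, two neighbours of `x` joined by a path through non-neighbours of `x`
are adjacent. -/
theorem IsChordal.adj_of_reachable {V : Type*} {G : SimpleGraph V} (hG : IsChordal G)
    {x s t : V} {B : Set V} (hxs : G.Adj x s) (hxt : G.Adj x t) (hst : s ≠ t)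
    (hB : ∀ w ∈ B, w ≠ x ∧ ¬ G.Adj x w)
    (h : (G.within (insert s (insert t B))).Reachable s t) : G.Adj s t := by
  by_contra hadj
  obtain ⟨p, hp, hlen⟩ := h.exists_path_of_dist
  have h2 : 1 < p.length := by
    rw [hlen]
    exact h.one_lt_dist_of_ne_of_not_adj hst fun h => hadj h.1
  have hmem : ∀ i ≤ p.length, p.getVert i ∈ insert s (insert t B) := by
    intro i hi
    rcases hi.lt_or_eq with hi | rfl
    · exact (p.adj_getVert_succ hi).2.1
    · simp
  have hinj := hp.getVert_injOn
  have hinner : ∀ i, 0 < i → i < p.length → p.getVert i ∈ B := by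
    intro i h0 hi
    rcases hmem i hi.le with h | h | h
    · have := hinj (x₁ := i) (x₂ := 0) hi.le (Nat.zero_le _) (by simpa using h)
      omega
    · have := hinj (x₁ := i) (x₂ := p.length) hi.le (le_refl p.length) (by simpa using h)
      omega
    · exact h
  have hshort : ∀ i j, i < j → j ≤ p.length → G.Adj (p.getVert i) (p.getVert j) → j = i + 1 := by
    intro i j hij hj hadj
    have hK : (G.within (insert s (insert t B))).Adj (p.getVert i) (p.getVert j) :=
      ⟨hadj, hmem i (by omega), hmem j hj⟩
    have := SimpleGraph.dist_le ((p.take i).append (.cons hK (p.drop j)))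
    rw [← hlen, Walk.length_append, Walk.length_cons, Walk.drop_length, Walk.take_length] at this
    omega
  have hne : ∀ i ≤ p.length, p.getVert i ≠ x := by
    intro i hi
    rcases hmem i hi with h | h | h
    · rw [h]; exact hxs.ne'
    · rw [h]; exact hxt.ne'
    · exact (hB _ h).1
  refine hG.not_isHole (n := p.length + 2) (by omega)
    (fun i => if i ≤ p.length then p.getVert i else x) fun i j hij hj => ?_
  have hi : i ≤ p.length := by omega
  simp only [hi, if_true]
  by_cases hj' : j ≤ p.length
  · simp only [hj', if_true]
    refine ⟨fun h => hij.ne (hinj hi hj' h), fun h => .inl (hshort i j hij hj' h), ?_⟩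
    rintro (rfl | h)
    · exact (p.adj_getVert_succ hj').1
    · omega
  · simp only [hj', if_false]
    refine ⟨hne i hi, fun h => ?_, ?_⟩
    · by_contra hcon
      exact (hB _ (hinner i (by omega) (by omega))).2 h.symm
    · rintro (h | h)
      · obtain rfl : i = p.length := by omega
        simpa using hxt.symm
      · rw [h.1]
        simpa using hxs.symm

/-- **Dirac's lemma**: any vertex of a chordal graph which has a non-neighbour has a simplicial
non-neighbour. -/
theorem IsChordal.exists_simplicial_not_adj {V : Type*} {G : SimpleGraph V} (hG : IsChordal G)
    (A : Finset V) : ∀ x ∈ A, (∃ y ∈ A, y ≠ x ∧ ¬ G.Adj x y) →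
      ∃ z ∈ A, z ≠ x ∧ ¬ G.Adj x z ∧
        ∀ a ∈ A, ∀ b ∈ A, G.Adj z a → G.Adj z b → a ≠ b → G.Adj a b := by
  classical
  induction A using Finset.strongInduction with
  | H A ih =>
  rintro x hx ⟨y, hyA, hyx, hxy⟩
  set B : Set V := {w | w ∈ A ∧ w ≠ x ∧ ¬ G.Adj x w}
  set C : Set V := {c | c ∈ B ∧ (G.within B).Reachable y c}
  set S : Set V := {s | s ∈ A ∧ G.Adj x s ∧ ∃ c ∈ C, G.Adj c s}
  have hyC : y ∈ C := ⟨⟨hyA, hyx, hxy⟩, .refl _⟩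
  have hclique : ∀ s ∈ S, ∀ t ∈ S, s ≠ t → G.Adj s t := by
    rintro s ⟨-, hxs, c, hc, hcs⟩ t ⟨-, hxt, d, hd, hdt⟩ hst
    refine hG.adj_of_reachable hxs hxt hst (B := B) (fun w hw => hw.2) ?_
    have hcd : (G.within (insert s (insert t B))).Reachable c d :=
      (hc.2.symm.trans hd.2).mono (G.within_mono fun w hw => .inr (.inr hw))
    refine (Adj.reachable ?_).trans (hcd.trans (Adj.reachable ?_))
    · exact ⟨hcs.symm, .inl rfl, .inr (.inr hc.1)⟩
    · exact ⟨hdt, .inr (.inr hd.1), .inr (.inl rfl)⟩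
  have hnbr : ∀ z ∈ C, ∀ a ∈ A, G.Adj z a → a ∈ C ∨ a ∈ S := by
    intro z hz a ha hza
    by_cases hxa : G.Adj x a
    · exact .inr ⟨ha, hxa, z, hz, hza⟩
    · have haB : a ∈ B := ⟨ha, fun h => hz.1.2.2 (h ▸ hza.symm), hxa⟩
      exact .inl ⟨haB, hz.2.trans (Adj.reachable ⟨hza, hz.1, haB⟩)⟩
  have hxC : x ∉ C := fun h => h.1.2.1 rfl
  have hxS : x ∉ S := fun h => h.2.1.ne rfl
  by_cases hcase : ∃ s ∈ S, ∃ w ∈ A.filter (fun w => w ∈ C ∨ w ∈ S), w ≠ s ∧ ¬ G.Adj s w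
  · obtain ⟨s, hs, hw⟩ := hcase
    obtain ⟨z, hzA, hzs, hsz, hz⟩ := ih (A.filter fun w => w ∈ C ∨ w ∈ S)
      (Finset.filter_ssubset.2 ⟨x, hx, by tauto⟩) s
      (Finset.mem_filter.2 ⟨hs.1, .inr hs⟩) hw
    rw [Finset.mem_filter] at hzA
    have hzC : z ∈ C := hzA.2.resolve_right fun h => hsz (hclique s hs z h hzs.symm)
    refine ⟨z, hzA.1, hzC.1.2.1, hzC.1.2.2, fun a ha b hb hza hzb hab => ?_⟩
    exact hz a (Finset.mem_filter.2 ⟨ha, hnbr z hzC a ha hza⟩) b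
      (Finset.mem_filter.2 ⟨hb, hnbr z hzC b hb hzb⟩) hza hzb hab
  · push Not at hcase
    obtain ⟨z, hzC, hz⟩ : ∃ z ∈ C, ∀ a ∈ A, a ∈ C → ∀ b ∈ A, b ∈ C →
        G.Adj z a → G.Adj z b → a ≠ b → G.Adj a b := by
      by_cases hcomp : ∀ a ∈ C, ∀ b ∈ C, a ≠ b → G.Adj a b
      · exact ⟨y, hyC, fun a _ ha b _ hb _ _ hab => hcomp a ha b hb hab⟩
      · push Not at hcomp
        obtain ⟨a, ha, b, hb, hab, hnab⟩ := hcomp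
        obtain ⟨z, hzA, -, -, hz⟩ := ih (A.filter fun w => w ∈ C)
          (Finset.filter_ssubset.2 ⟨x, hx, hxC⟩) a (Finset.mem_filter.2 ⟨ha.1.1, ha⟩)
          ⟨b, Finset.mem_filter.2 ⟨hb.1.1, hb⟩, hab.symm, hnab⟩
        exact ⟨z, (Finset.mem_filter.1 hzA).2, fun a ha haC b hb hbC =>
          hz a (Finset.mem_filter.2 ⟨ha, haC⟩) b (Finset.mem_filter.2 ⟨hb, hbC⟩)⟩
    refine ⟨z, hzC.1.1, hzC.1.2.1, hzC.1.2.2, fun a ha b hb hza hzb hab => ?_⟩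
    have haCS := hnbr z hzC a ha hza
    have hbCS := hnbr z hzC b hb hzb
    by_cases haS : a ∈ S
    · exact hcase a haS b (Finset.mem_filter.2 ⟨hb, hbCS⟩) hab.symm
    by_cases hbS : b ∈ S
    · exact (hcase b hbS a (Finset.mem_filter.2 ⟨ha, haCS⟩) hab).symm
    exact hz a ha (haCS.resolve_right haS) b hb (hbCS.resolve_right hbS) hza hzb hab

theorem IsChordal.exists_simplicial {V : Type*} {G : SimpleGraph V} (hG : IsChordal G)
    {A : Finset V} (hA : A.Nonempty) :
    ∃ z ∈ A, ∀ a ∈ A, ∀ b ∈ A, G.Adj z a → G.Adj z b → a ≠ b → G.Adj a b := by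
  by_cases h : ∀ a ∈ A, ∀ b ∈ A, a ≠ b → G.Adj a b
  · obtain ⟨z, hz⟩ := hA
    exact ⟨z, hz, fun a ha b hb _ _ hab => h a ha b hb hab⟩
  · push Not at h
    obtain ⟨a, ha, b, hb, hab, hnab⟩ := h
    obtain ⟨z, hz, -, -, h⟩ := hG.exists_simplicial_not_adj A a ha ⟨b, hb, hab.symm, hnab⟩
    exact ⟨z, hz, h⟩

/-- A finite chordal graph has a perfect elimination ordering. -/
theorem IsChordal.exists_perfect_elimination {V : Type*} [Finite V] {G : SimpleGraph V}
    (hG : IsChordal G) : ∃ r : V → ℕ, Function.Injective r ∧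
      ∀ v a b, G.Adj v a → G.Adj v b → r v < r a → r v < r b → a ≠ b → G.Adj a b := by
  classical
  have := Fintype.ofFinite V
  suffices h : ∀ A : Finset V, ∃ r : V → ℕ, Set.InjOn r A ∧ ∀ v ∈ A, ∀ a ∈ A, ∀ b ∈ A,
      G.Adj v a → G.Adj v b → r v < r a → r v < r b → a ≠ b → G.Adj a b by
    obtain ⟨r, hr, h⟩ := h Finset.univ
    exact ⟨r, by simpa using hr, by simpa using h⟩
  intro A
  induction A using Finset.strongInduction with
  | H A ih =>
  rcases A.eq_empty_or_nonempty with rfl | hA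
  · exact ⟨fun _ => 0, by simp, by simp⟩
  obtain ⟨z, hzA, hz⟩ := hG.exists_simplicial hA
  obtain ⟨r, hr, h⟩ := ih (A.erase z) (Finset.erase_ssubset hzA)
  refine ⟨fun v => if v = z then 0 else r v + 1, fun a ha b hb hab => ?_,
    fun v hv a ha b hb hva hvb hra hrb hab => ?_⟩
  · by_cases haz : a = z <;> by_cases hbz : b = z <;> simp [haz, hbz] at hab ⊢
    exact hr (by simpa [haz] using ha) (by simpa [hbz] using hb) hab
  · have haz : a ≠ z := by rintro rfl; simp at hra
    have hbz : b ≠ z := by rintro rfl; simp at hrb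
    by_cases hvz : v = z
    · subst hvz
      exact hz a ha b hb hva hvb hab
    · simp only [hvz, haz, hbz, if_false, Nat.add_lt_add_iff_right] at hra hrb
      exact h v (by simp [hvz, hv]) a (by simp [haz, ha]) b (by simp [hbz, hb]) hva hvb hra hrb hab

/-- Greedy colouring of an acyclic digraph of bounded out-degree. -/
theorem exists_coloring_of_outdegree_le {V : Type*} [Finite V] (r : V → ℕ) (D : V → V → Prop)
    (hD : ∀ v w, D v w → r v < r w) (d : ℕ) (hd : ∀ v, {w | D v w}.ncard ≤ d) :
    ∃ c : V → Fin (d + 1), ∀ v w, D v w → c v ≠ c w := by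
  classical
  have := Fintype.ofFinite V
  suffices h : ∀ A : Finset V, ∃ c : V → Fin (d + 1), ∀ v ∈ A, ∀ w ∈ A, D v w → c v ≠ c w by
    obtain ⟨c, hc⟩ := h Finset.univ
    exact ⟨c, by simpa using hc⟩
  intro A
  induction A using Finset.induction_on_min_value r with
  | empty => exact ⟨fun _ => 0, by simp⟩
  | insert a s ha hmin ih =>
    obtain ⟨c, hc⟩ := ih
    obtain ⟨x, hx⟩ : ∃ x, x ∉ c '' {w | D a w} := by
      by_contra! h
      have h1 := Set.ncard_image_le (f := c) (Set.toFinite {w | D a w})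
      rw [Set.eq_univ_of_forall h, Set.ncard_univ, Nat.card_fin] at h1
      have := hd a
      omega
    refine ⟨fun v => if v = a then x else c v, fun v hv w hw hvw => ?_⟩
    have hlt := hD v w hvw
    have hwa : w ≠ a := by
      rintro rfl
      rcases Finset.mem_insert.1 hv with rfl | hv
      · exact lt_irrefl _ hlt
      · exact absurd (hmin v hv) (not_le.2 hlt)
    by_cases hva : v = a
    · subst hva
      simp only [if_true, hwa, if_false]
      exact fun h => hx ⟨w, hvw, h.symm⟩
    · simp only [hva, hwa, if_false]
      exact hc v ((Finset.mem_insert.1 hv).resolve_left hva) w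
        ((Finset.mem_insert.1 hw).resolve_left hwa) hvw

theorem SimpleGraph.edgeSet_eq_of_mem {V : Type*} {G : SimpleGraph V} {e f : G.edgeSet} {u v : V}
    (huv : u ≠ v) (hue : u ∈ (e : Sym2 V)) (hve : v ∈ (e : Sym2 V)) (huf : u ∈ (f : Sym2 V))
    (hvf : v ∈ (f : Sym2 V)) : e = f :=
  Subtype.ext <| ((Sym2.mem_and_mem_iff huv).1 ⟨hue, hve⟩).trans
    ((Sym2.mem_and_mem_iff huv).1 ⟨huf, hvf⟩).symm

/-- Given a perfect elimination ordering of a subgraph of a line graph, every edge has an end which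
is contained in all but at most one of its later neighbours. -/
theorem exists_head {V : Type*} {G : SimpleGraph V} {H : SimpleGraph G.edgeSet}
    (hH : H ≤ G.lineGraph) {r : G.edgeSet → ℕ}
    (hr : ∀ v a b, H.Adj v a → H.Adj v b → r v < r a → r v < r b → a ≠ b → H.Adj a b)
    (e : G.edgeSet) : ∃ v ∈ (e : Sym2 V),
      {f | H.Adj e f ∧ r e < r f ∧ v ∉ (f : Sym2 V)}.Subsingleton := by
  obtain ⟨e, he⟩ := e
  induction e with
  | h u v =>
  have huv : u ≠ v := G.ne_of_adj he
  have hmeet : ∀ f, H.Adj ⟨s(u, v), he⟩ f → u ∈ (f : Sym2 V) ∨ v ∈ (f : Sym2 V) := by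
    intro f hf
    obtain ⟨-, w, hw, hwf⟩ := lineGraph_adj_iff_exists.1 (hH hf)
    rcases Sym2.mem_iff.1 hw with rfl | rfl
    · exact .inl hwf
    · exact .inr hwf
  by_contra! hcon
  obtain ⟨g, ⟨heg, hrg, hug⟩, -⟩ := hcon u (Sym2.mem_mk_left u v)
  obtain ⟨f₁, ⟨hef₁, hrf₁, hvf₁⟩, f₂, ⟨hef₂, hrf₂, hvf₂⟩, hf⟩ := hcon v (Sym2.mem_mk_right u v)
  have hvg := (hmeet g heg).resolve_left hug
  have huf₁ := (hmeet f₁ hef₁).resolve_right hvf₁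
  have huf₂ := (hmeet f₂ hef₂).resolve_right hvf₂
  have hgf₁ := hr _ g f₁ heg hef₁ hrg hrf₁ (by rintro rfl; exact hug huf₁)
  have hgf₂ := hr _ g f₂ heg hef₂ hrg hrf₂ (by rintro rfl; exact hug huf₂)
  obtain ⟨-, w₁, hw₁g, hw₁f⟩ := lineGraph_adj_iff_exists.1 (hH hgf₁)
  obtain ⟨-, w₂, hw₂g, hw₂f⟩ := lineGraph_adj_iff_exists.1 (hH hgf₂)
  have hw₁v : v ≠ w₁ := by rintro rfl; exact hvf₁ hw₁f
  have hw₂v : v ≠ w₂ := by rintro rfl; exact hvf₂ hw₂f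
  have hw₁u : u ≠ w₁ := by rintro rfl; exact hug hw₁g
  have hg := (Sym2.mem_and_mem_iff hw₁v).1 ⟨hvg, hw₁g⟩
  rw [hg, Sym2.mem_iff] at hw₂g
  obtain rfl := hw₂g.resolve_left hw₂v.symm
  exact hf (edgeSet_eq_of_mem hw₁u huf₁ hw₁f huf₂ hw₂f)

theorem ncard_le_two_of_forall_min {α : Type*} [Finite α] {r : α → ℕ} (hr : r.Injective)
    {s : Set α} (hs : ∀ a ∈ s, {b ∈ s | r a < r b}.Subsingleton) : s.ncard ≤ 2 := by
  by_contra! h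
  obtain ⟨m, hm, hmin⟩ := Set.exists_min_image s r s.toFinite
    (Set.nonempty_of_ncard_ne_zero (by omega))
  have hsub : s \ {m} ⊆ {b ∈ s | r m < r b} := fun b hb =>
    ⟨hb.1, (hmin b hb.1).lt_of_ne fun h => hb.2 (hr h).symm⟩
  have h1 := Set.ncard_le_one_iff_subsingleton.2 ((hs m hm).anti hsub)
  have h2 := Set.ncard_sdiff_singleton_add_one hm
  omega

/-- For a chordal subgraph `H` of a line graph, the edges of the underlying graph can be directed
and coloured so that `H` joins edges of the same colour only if they form an elbow. -/
theorem exists_head_coloring {V : Type*} [Finite V] {G : SimpleGraph V} {H : SimpleGraph G.edgeSet}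
    (hH : H ≤ G.lineGraph) (hc : IsChordal H) :
    ∃ (head : G.edgeSet → V) (p : G.edgeSet → Fin 4),
      (∀ e : G.edgeSet, head e ∈ (e : Sym2 V)) ∧ ∀ e f, H.Adj e f → p e = p f → head e = head f := by
  obtain ⟨r, hinj, hr⟩ := hc.exists_perfect_elimination
  choose head hhead hsub using exists_head hH hr
  have hdeg : ∀ e, {f | H.Adj e f ∧ r e < r f ∧ head f ≠ head e}.ncard ≤ 3 := by
    intro e
    set T : Set G.edgeSet := {f | H.Adj e f ∧ r e < r f ∧ head e ∉ (f : Sym2 V)}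
    set S : Set G.edgeSet :=
      {f | H.Adj e f ∧ r e < r f ∧ head e ∈ (f : Sym2 V) ∧ head f ≠ head e}
    have hsplit : {f | H.Adj e f ∧ r e < r f ∧ head f ≠ head e} ⊆ T ∪ S := by
      rintro f ⟨h1, h2, h3⟩
      by_cases h : head e ∈ (f : Sym2 V)
      · exact .inr ⟨h1, h2, h, h3⟩
      · exact .inl ⟨h1, h2, h⟩
    have hT : T.ncard ≤ 1 := Set.ncard_le_one_iff_subsingleton.2 (hsub e)
    have hS : S.ncard ≤ 2 := by
      refine ncard_le_two_of_forall_min hinj fun a ha => (hsub a).anti ?_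
      rintro b ⟨hb, hab⟩
      have hne : a ≠ b := by rintro rfl; exact lt_irrefl _ hab
      exact ⟨hr e a b ha.1 hb.1 ha.2.1 hb.2.1 hne, hab, fun h =>
        hne (edgeSet_eq_of_mem ha.2.2.2 (hhead a) ha.2.2.1 h hb.2.2.1)⟩
    have h1 := Set.ncard_le_ncard hsplit
    have h2 := Set.ncard_union_le T S
    omega
  obtain ⟨p, hp⟩ := exists_coloring_of_outdegree_le r
    (fun e f => H.Adj e f ∧ r e < r f ∧ head f ≠ head e) (fun _ _ h => h.2.1) 3 hdeg
  refine ⟨head, p, hhead, fun e f hef hpef => ?_⟩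
  by_contra hne
  rcases lt_trichotomy (r e) (r f) with h | h | h
  · exact hp e f ⟨hef, h, Ne.symm hne⟩ hpef
  · exact hef.ne (hinj h)
  · exact hp f e ⟨hef.symm, h, hne⟩ hpef.symm

/-- If the line graph of `G` is covered by `k ≠ 0` chordal graphs, then the chromatic number of `G`
is bounded in terms of `k`. -/
theorem colorable_of_chordal_cover {V : Type*} [Finite V] {G : SimpleGraph V} {k : ℕ} [NeZero k]
    (H : Fin k → SimpleGraph G.edgeSet) (hH : ∀ i, IsChordal (H i))
    (hcover : ⨆ i, H i = G.lineGraph) :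
    G.Colorable (Fintype.card (Set (Fin k → Prop × Fin 4))) := by
  choose head p hhead hp using fun i =>
    exists_head_coloring (hcover ▸ le_iSup H i : H i ≤ G.lineGraph) (hH i)
  let label (v : V) (e : G.edgeSet) : Fin k → Prop × Fin 4 := fun i => (head i e = v, p i e)
  refine (Coloring.mk (fun v => {l | ∃ e : G.edgeSet, v ∈ (e : Sym2 V) ∧ label v e = l})
    fun {u v} huv heq => ?_).colorable
  have hmem : label u ⟨s(u, v), huv⟩ ∈
      {l | ∃ e : G.edgeSet, u ∈ (e : Sym2 V) ∧ label u e = l} := ⟨_, Sym2.mem_mk_left u v, rfl⟩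
  rw [heq] at hmem
  obtain ⟨f, hvf, hf⟩ := hmem
  have hlab (i : Fin k) : (head i f = v ↔ head i ⟨s(u, v), huv⟩ = u) ∧
      p i f = p i ⟨s(u, v), huv⟩ := by
    have := congrFun hf i
    simpa [label] using this
  have hdir (i : Fin k) : head i ⟨s(u, v), huv⟩ ≠ head i f := by
    intro h
    have h1 := (hlab i).1
    rw [← h] at h1
    rcases Sym2.mem_iff.1 (hhead i ⟨s(u, v), huv⟩) with h2 | h2
    · exact huv.ne (h2.symm.trans (h1.2 h2))
    · exact huv.ne ((h1.1 h2).symm.trans h2)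
  have hne : (⟨s(u, v), huv⟩ : G.edgeSet) ≠ f := fun h => hdir 0 (by rw [h])
  have hadj : G.lineGraph.Adj ⟨s(u, v), huv⟩ f :=
    lineGraph_adj_iff_exists.2 ⟨hne, v, Sym2.mem_mk_right u v, hvf⟩
  rw [← hcover, iSup_adj] at hadj
  obtain ⟨i, hi⟩ := hadj
  exact hdir i (hp i _ f hi (hlab i).2.symm)

theorem isChordal_of_forall_adj {V : Type*} {G : SimpleGraph V} {a b : V}
    (h : ∀ u v, G.Adj u v → s(u, v) = s(a, b)) : IsChordal G := by
  refine fun n hn => ⟨fun φ => ?_⟩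
  obtain ⟨n, rfl⟩ : ∃ m, n = m + 3 := ⟨n - 3, by omega⟩
  have h01 : (cycleGraph (n + 3)).Adj 0 1 := by simp [cycleGraph_adj]
  have h12 : (cycleGraph (n + 3)).Adj 1 2 := by
    rw [cycleGraph_adj]
    exact .inr (sub_eq_of_eq_add (by simp [Fin.ext_iff, Fin.val_add]))
  have h1 := h _ _ (φ.map_rel_iff.2 h01)
  have h2 := h _ _ (φ.map_rel_iff.2 h12)
  have := h1.trans h2.symm
  rw [← Sym2.map_mk, ← Sym2.map_mk] at this
  have := Sym2.map.injective φ.injective this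
  simp [Fin.ext_iff] at this
  rw [Nat.mod_eq_of_lt (by omega)] at this
  omega

theorem isChordal_bot {V : Type*} : IsChordal (⊥ : SimpleGraph V) := by
  refine fun n hn => ⟨fun φ => ?_⟩
  obtain ⟨n, rfl⟩ : ∃ m, n = m + 2 := ⟨n - 2, by omega⟩
  exact φ.map_rel_iff.2 (by simp [cycleGraph_adj] : (cycleGraph (n + 2)).Adj 0 1)

/-- Every finite graph is a union of chordal graphs. -/
theorem exists_chordal_cover {V : Type*} [Finite V] (G : SimpleGraph V) :
    ∃ (k : ℕ) (f : Fin k → SimpleGraph V), (∀ i, IsChordal (f i)) ∧ ⨆ i, f i = G := by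
  obtain ⟨k, ⟨σ⟩⟩ := Finite.exists_equiv_fin G.edgeSet
  refine ⟨k, fun i => fromEdgeSet {(σ.symm i : Sym2 V)}, fun i => ?_, ?_⟩
  · obtain ⟨a, b, hab⟩ : ∃ a b, (σ.symm i : Sym2 V) = s(a, b) :=
      ⟨_, _, (Quot.out_eq (σ.symm i : Sym2 V)).symm⟩
    refine isChordal_of_forall_adj (a := a) (b := b) fun u v huv => ?_
    rw [fromEdgeSet_adj] at huv
    exact huv.1.trans hab
  · ext u v
    simp only [iSup_adj, fromEdgeSet_adj, Set.mem_singleton_iff]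
    constructor
    · rintro ⟨i, hi, -⟩
      rw [← mem_edgeSet, hi]
      exact (σ.symm i).2
    · intro h
      exact ⟨σ ⟨s(u, v), h⟩, by simp, h.ne⟩

theorem exists_chordalCoverNumber_cover {V : Type*} [Finite V] (G : SimpleGraph V) :
    ∃ f : Fin (chordalCoverNumber G) → SimpleGraph V,
      (∀ i, IsChordal (f i)) ∧ ⨆ i, f i = G :=
  Nat.sInf_mem (exists_chordal_cover G)

theorem stmt_11 (b : ℕ) :
    ∃ c : ℕ, ∀ (V : Type) [Fintype V] (G : SimpleGraph V),
      (c : ℕ∞) ≤ G.chromaticNumber → b < chordalCoverNumber G.lineGraph := by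
  refine ⟨Fintype.card (Set (Fin (b + 1) → Prop × Fin 4)) + 1, fun V _ G hχ => ?_⟩
  by_contra! hle
  obtain ⟨f, hf, hcover⟩ := exists_chordalCoverNumber_cover G.lineGraph
  have hcol : G.Colorable (Fintype.card (Set (Fin (b + 1) → Prop × Fin 4))) := by
    refine colorable_of_chordal_cover
      (fun i => if h : i.1 < chordalCoverNumber G.lineGraph then f ⟨i, h⟩ else ⊥)
      (fun i => ?_) (le_antisymm (iSup_le fun i => ?_) ?_)
    · split_ifs with h
      · exact hf _
      · exact isChordal_bot
    · split_ifs with h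
      · exact (le_iSup f ⟨i, h⟩).trans hcover.le
      · exact bot_le
    · refine hcover.ge.trans (iSup_le fun i => ?_)
      refine le_iSup_of_le ⟨i, by omega⟩ ?_
      simp
  have := hχ.trans (chromaticNumber_le_iff_colorable.2 hcol)
  norm_cast at this
  omega
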